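/- For every infinite set M and every natural number n, there is no finite-to-one function from the power set 𝒫(M) to the n-fold Cartesian power Mⁿ. -/

import Mathlib

/-- For every infinite set `M` and every natural number `n`, there is no
finite-to-one function from the power set `𝒫(M)` to `Mⁿ`. -/
theorem no_finiteToOne_powerset_to_pow (M : Type*) [Infinite M] (n : ℕ) :
    ¬ ∃ f : Set M → (Fin n → M), ∀ y : Fin n → M, (f ⁻¹' {y}).Finite := by
  rintro ⟨f, hf⟩
  have card_lt : Cardinal.mk (Fin n → M) < Cardinal.mk (Set M) :=
    calc Cardinal.mk (Fin n → M) = Cardinal.mk M ^ n := by simp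
      _ ≤ Cardinal.mk M := Cardinal.power_nat_le (Cardinal.aleph0_le_mk M)
      _ < Cardinal.mk (Set M) := by
        rw [Cardinal.mk_set]
        exact Cardinal.cantor _
  obtain ⟨y, hy⟩ := Cardinal.exists_infinite_fiber f card_lt
  exact Set.infinite_coe_iff.mp hy (hf y)
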